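/- arXiv:2112.05486 — 6 statements merged into one kernel-verified Lean document; each statement's English description precedes it below -/
import Mathlib

section
/- Let G be a finite simple graph with no isolated vertices, and suppose G contains a shortest path P (a path whose length equals the distance between its endpoints) with exactly t vertices such that the vertex set of P is a dominating set of G. Then every paired dominating set D of G satisfies |D| ≥ 2·⌈t/4⌉. In particular, γ_pr(G) ≥ 2·⌈t/4⌉. -/
/-- `D` is a dominating set of `G`: every vertex lies in the closed neighborhood of
some vertex of `D`. -/
def IsDominating {V : Type*} (G : SimpleGraph V) (D : Set V) : Prop :=
  ∀ v : V, ∃ u ∈ D, u = v ∨ G.Adj u v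

/-- `D` is a paired dominating set of `G`: it is dominating and the subgraph of `G`
induced by `D` has a perfect matching, i.e. there is a matching subgraph of `G` whose
vertex set is exactly `D`. -/
def IsPairedDominating {V : Type*} (G : SimpleGraph V) (D : Set V) : Prop :=
  IsDominating G D ∧ ∃ M : G.Subgraph, M.verts = D ∧ M.IsMatching

/-- Any two vertices lying in the closed neighborhoods of the endpoints of an edge are joined
by a walk of length at most three. -/
lemma exists_short_walk {V : Type*} (G : SimpleGraph V) {d e a b : V} (hde : G.Adj d e)
    (ha : (d = a ∨ G.Adj d a) ∨ (e = a ∨ G.Adj e a))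
    (hb : (d = b ∨ G.Adj d b) ∨ (e = b ∨ G.Adj e b)) :
    ∃ q : G.Walk a b, q.length ≤ 3 := by
  have key : ∀ {u v : V}, (u = v ∨ G.Adj u v) → ∃ q : G.Walk u v, q.length ≤ 1 := by
    rintro u v (rfl | h)
    · exact ⟨.nil, by simp⟩
    · exact ⟨.cons h .nil, by simp⟩
  have fin : ∀ {u v : V}, (u = v ∨ G.Adj u v) → (u = a ∨ G.Adj u a) → (v = b ∨ G.Adj v b) →
      ∃ q : G.Walk a b, q.length ≤ 3 := by
    intro u v h1 h2 h3
    obtain ⟨q1, h1⟩ := key h1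
    obtain ⟨q2, h2⟩ := key h2
    obtain ⟨q3, h3⟩ := key h3
    refine ⟨q2.reverse.append (q1.append q3), ?_⟩
    simp only [SimpleGraph.Walk.length_append, SimpleGraph.Walk.length_reverse]
    omega
  rcases ha with ha | ha <;> rcases hb with hb | hb
  · exact fin (.inl rfl) ha hb
  · exact fin (.inr hde) ha hb
  · exact fin (.inr hde.symm) ha hb
  · exact fin (.inl rfl) ha hb

/-- Indices on a shortest path differ by at most the length of any connecting walk. -/
lemma index_le_of_walk {V : Type*} (G : SimpleGraph V) {x y : V} (p : G.Walk x y)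
    (hshort : p.length = G.dist x y) {i j : ℕ} (hi : i ≤ p.length) (hj : j ≤ p.length)
    (q : G.Walk (p.getVert i) (p.getVert j)) : j ≤ i + q.length := by
  have h := SimpleGraph.dist_le ((p.take i).append (q.append (p.drop j)))
  simp only [SimpleGraph.Walk.length_append, SimpleGraph.Walk.take_length,
    SimpleGraph.Walk.drop_length] at h
  omega

/-- If a finite simple graph `G` without isolated vertices has a shortest path `P` with
exactly `t` vertices whose vertex set is a dominating set, then every paired dominating
set `D` of `G` satisfies `|D| ≥ 2⌈t/4⌉`. -/
theorem pd_set_lower_bound {V : Type*} [Fintype V] (G : SimpleGraph V)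
    (hiso : ∀ v : V, ∃ u : V, G.Adj v u)
    {x y : V} (p : G.Walk x y) (hpath : p.IsPath) (hshort : p.length = G.dist x y)
    (t : ℕ) (ht : p.support.length = t)
    (hdom : IsDominating G {v : V | v ∈ p.support})
    (D : Finset V) (hD : IsPairedDominating G (↑D : Set V)) :
    2 * ⌈(t : ℚ) / 4⌉ ≤ (D.card : ℤ) := by
  classical
  obtain ⟨hDdom, M, hMv, hM⟩ := hD
  have hex : ∀ v : V, ∃ w, v ∈ D → M.Adj v w := by
    intro v
    by_cases hv : v ∈ D
    · obtain ⟨w, hw, -⟩ := hM (v := v) (by rw [hMv]; exact hv)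
      exact ⟨w, fun _ => hw⟩
    · exact ⟨v, fun h => absurd h hv⟩
  choose m hm using hex
  have hmD : ∀ v ∈ D, m v ∈ D := by
    intro v hv
    have := M.edge_vert (hm v hv).symm
    rw [hMv] at this
    exact this
  have hmm : ∀ v ∈ D, m (m v) = v := by
    intro v hv
    exact (hM (v := m v) (by rw [hMv]; exact hmD v hv)).unique (hm _ (hmD v hv)) (hm v hv).symm
  have hlen : p.length + 1 = t := by rw [← ht, SimpleGraph.Walk.length_support]
  let r : ℕ → V → Prop := fun i d =>
    (d = p.getVert i ∨ G.Adj d (p.getVert i)) ∨ (m d = p.getVert i ∨ G.Adj (m d) (p.getVert i))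
  have hcount : (Finset.range t).card * 2 ≤ D.card * 4 := by
    apply Finset.card_mul_le_card_mul r
    · intro i _
      obtain ⟨d, hd, hdi⟩ := hDdom (p.getVert i)
      have hd' : d ∈ D := hd
      have hne : d ≠ m d := (M.adj_sub (hm d hd')).ne
      rw [← Finset.card_pair hne]
      apply Finset.card_le_card
      intro z hz
      rw [Finset.mem_bipartiteAbove]
      simp only [Finset.mem_insert, Finset.mem_singleton] at hz
      rcases hz with rfl | rfl
      · exact ⟨hd', .inl hdi⟩
      · refine ⟨hmD d hd', .inr ?_⟩
        rw [hmm d hd']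
        exact hdi
    · intro d hd
      rcases (Finset.bipartiteBelow r (Finset.range t) d).eq_empty_or_nonempty with h | h
      · rw [h]; simp
      · set S := Finset.bipartiteBelow r (Finset.range t) d with hS
        have hsub : S ⊆ Finset.Icc (S.min' h) (S.min' h + 3) := by
          intro j hj
          have h0 := S.min'_mem h
          have hle := S.min'_le j hj
          generalize S.min' h = i at *
          rw [hS, Finset.mem_bipartiteBelow, Finset.mem_range] at h0 hj
          obtain ⟨q, hq⟩ := exists_short_walk G (M.adj_sub (hm d hd)) h0.2 hj.2
          have := index_le_of_walk G p hshort (by omega) (by omega) q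
          rw [Finset.mem_Icc]
          omega
        have := Finset.card_le_card hsub
        rw [Nat.card_Icc] at this
        omega
  rw [Finset.card_range] at hcount
  have heven : Even D.card := by
    have hMD : M.verts.toFinset = D := by
      ext v
      simp [hMv]
    rw [← hMD]
    exact hM.even_card
  obtain ⟨k, hk⟩ := heven
  have hceil : ⌈(t : ℚ) / 4⌉ ≤ (k : ℤ) := by
    rw [Int.ceil_le, div_le_iff₀ (by norm_num)]
    have : t ≤ k * 4 := by omega
    exact_mod_cast this
  omega
end

section
/- Let G be a finite connected simple graph with at least two vertices, and let P be a shortest path in G (a path whose length equals the distance between its endpoints) with exactly t vertices, where t is odd, such that the vertex set of P is a dominating set of G. Then G has a paired dominating set D with |D| ≤ t + 1. -/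
lemma list_matching_aux {V : Type*} (G : SimpleGraph V) :
    ∀ l : List V, l.IsChain G.Adj → l.Nodup → Even l.length →
      ∃ M : G.Subgraph, M.verts = {v | v ∈ l} ∧ M.IsMatching
  | [], _, _, _ => ⟨⊥, by simp, by intro v hv; simp at hv⟩
  | [a], _, _, h => by simp at h
  | a :: b :: l, hc, hn, he => by
    have hab : G.Adj a b := by
      simp only [List.isChain_cons_cons] at hc
      exact hc.1
    have hc' : l.IsChain G.Adj := hc.tail.tail
    have he' : Even l.length := by
      simp only [List.length_cons] at he
      rcases he with ⟨k, hk⟩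
      exact ⟨k - 1, by omega⟩
    simp only [List.nodup_cons, List.mem_cons, not_or] at hn
    obtain ⟨M, hv, hM⟩ := list_matching_aux G l hc' hn.2.2 he'
    refine ⟨G.subgraphOfAdj hab ⊔ M, ?_, ?_⟩
    · ext v
      simp [hv, or_assoc]
    · have h1 : (G.subgraphOfAdj hab).IsMatching :=
        SimpleGraph.Subgraph.IsMatching.subgraphOfAdj hab
      refine h1.sup hM ?_
      rw [h1.support_eq_verts, hM.support_eq_verts, hv, Set.disjoint_left]
      intro v h h2
      simp only [SimpleGraph.subgraphOfAdj_verts, Set.mem_insert_iff,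
        Set.mem_singleton_iff, Set.mem_ofPred_eq] at h h2
      rcases h with rfl | rfl
      · exact hn.1.2 h2
      · exact hn.2.1 h2

lemma pd_of_list_aux {V : Type*} (G : SimpleGraph V) (l : List V)
    (hc : l.IsChain G.Adj) (hn : l.Nodup) (he : Even l.length)
    (hd : IsDominating G {v | v ∈ l}) (n : ℕ) (hl : l.length ≤ n) :
    ∃ D : Finset V, IsPairedDominating G (↑D : Set V) ∧ D.card ≤ n := by
  classical
  have h : (↑l.toFinset : Set V) = {v | v ∈ l} := by ext; simp
  refine ⟨l.toFinset, ?_, (List.toFinset_card_le l).trans hl⟩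
  rw [h]
  exact ⟨hd, list_matching_aux G l hc hn he⟩

theorem pd_set_from_odd_dominating_shortest_path {V : Type*} [Fintype V]
    (G : SimpleGraph V) (hconn : G.Connected) (hcard : 2 ≤ Fintype.card V)
    {x y : V} (p : G.Walk x y) (hpath : p.IsPath) (hshort : p.length = G.dist x y)
    (t : ℕ) (ht : p.support.length = t) (hodd : Odd t)
    (hdom : IsDominating G {v : V | v ∈ p.support}) :
    ∃ D : Finset V, IsPairedDominating G (↑D : Set V) ∧ D.card ≤ t + 1 := by
  have hchain := p.isChain_adj_support
  have hnd := hpath.support_nodup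
  by_cases hw : ∃ w, G.Adj x w ∧ w ∉ p.support
  · obtain ⟨w, hxw, hws⟩ := hw
    refine pd_of_list_aux G (w :: p.support) ?_ (List.nodup_cons.2 ⟨hws, hnd⟩) ?_ ?_ _ ?_
    · rw [← p.cons_tail_support] at hchain ⊢
      exact List.isChain_cons_cons.2 ⟨hxw.symm, hchain⟩
    · rw [List.length_cons, ht]; exact hodd.add_one
    · intro v
      obtain ⟨u, hu, h⟩ := hdom v
      exact ⟨u, List.mem_cons_of_mem _ hu, h⟩
    · rw [List.length_cons, ht]
  · push Not at hw
    have : Nontrivial V := Fintype.one_lt_card_iff_nontrivial.1 hcard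
    obtain ⟨z, hz⟩ := hconn.preconnected.exists_adj_of_nontrivial x
    have key : ∀ w, G.Adj x w → w ∈ p.support.tail := by
      intro w h
      have := hw w h
      rw [← p.cons_tail_support, List.mem_cons] at this
      exact this.resolve_left h.ne'
    refine pd_of_list_aux G p.support.tail hchain.tail hnd.tail ?_ ?_ _ ?_
    · rw [List.length_tail, ht]; exact hodd.tsub_odd odd_one
    · intro v
      obtain ⟨u, hu, h⟩ := hdom v
      rw [Set.mem_ofPred_eq, ← p.cons_tail_support, List.mem_cons] at hu
      rcases hu with rfl | hu
      · rcases h with rfl | h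
        · exact ⟨z, key z hz, Or.inr hz.symm⟩
        · exact ⟨v, key v h, Or.inl rfl⟩
      · exact ⟨u, hu, h⟩
    · rw [List.length_tail, ht]; omega
end

section
/- Let G be a finite connected simple graph with at least two vertices, and let P be a shortest path in G (a path whose length equals the distance between its endpoints) with exactly t vertices such that the vertex set of P is a dominating set of G. Then γ_pr(G) ≤ t + 1, i.e., G has a paired dominating set of cardinality at most t + 1. -/
/-- The paired domination number `γ_pr(G)`: the minimum cardinality of a paired
dominating set of `G`. -/
noncomputable def pairedDominationNumber {V : Type*} [Fintype V] (G : SimpleGraph V) : ℕ :=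
  sInf {n : ℕ | ∃ D : Finset V, IsPairedDominating G (↑D : Set V) ∧ D.card = n}

open SimpleGraph in
lemma exists_matching_of_odd_path {V : Type*} (G : SimpleGraph V) :
    ∀ {x y : V} (p : G.Walk x y), p.IsPath → Odd p.length →
      ∃ M : G.Subgraph, M.verts = {v : V | v ∈ p.support} ∧ M.IsMatching
  | _, _, .nil, _, ho => by simp at ho
  | _, _, .cons h .nil, _, _ => by
      refine ⟨G.subgraphOfAdj h, ?_, Subgraph.IsMatching.subgraphOfAdj h⟩
      ext v
      simp
  | _, _, .cons h (.cons h' q), hp, ho => by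
      have hq : q.IsPath := by
        simp only [Walk.cons_isPath_iff] at hp
        exact hp.1.1
      have hoq : Odd q.length := by
        simp only [Walk.length_cons] at ho
        rcases ho with ⟨k, hk⟩
        exact ⟨k - 1, by omega⟩
      obtain ⟨M, hM, hMm⟩ := exists_matching_of_odd_path G q hq hoq
      simp only [Walk.cons_isPath_iff, Walk.support_cons, List.mem_cons, not_or] at hp
      refine ⟨G.subgraphOfAdj h ⊔ M, ?_, (Subgraph.IsMatching.subgraphOfAdj h).sup hMm ?_⟩
      · ext v
        simp [hM, or_assoc]
      · rw [(Subgraph.IsMatching.subgraphOfAdj h).support_eq_verts, hMm.support_eq_verts, hM,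
          Set.disjoint_left]
        intro v hv hv'
        simp only [subgraphOfAdj_verts, Set.mem_insert_iff, Set.mem_singleton_iff] at hv
        rcases hv with rfl | rfl
        · exact hp.2.2 hv'
        · exact hp.1.2 hv'

open SimpleGraph in
lemma pd_of_odd_path {V : Type*} [Fintype V] (G : SimpleGraph V) {x y : V} (p : G.Walk x y)
    (hp : p.IsPath) (ho : Odd p.length) (hdom : IsDominating G {v : V | v ∈ p.support}) :
    ∃ D : Finset V, IsPairedDominating G (↑D : Set V) ∧ D.card ≤ p.length + 1 := by
  classical
  have e : (↑p.support.toFinset : Set V) = {v : V | v ∈ p.support} := by ext v; simp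
  refine ⟨p.support.toFinset, ?_, ?_⟩
  · rw [e]
    exact ⟨hdom, exists_matching_of_odd_path G p hp ho⟩
  · rw [← Walk.length_support]
    exact List.toFinset_card_le _

/-- If a finite connected simple graph `G` with at least two vertices has a shortest
path `P` with exactly `t` vertices whose vertex set is a dominating set, then
`γ_pr(G) ≤ t + 1`, i.e. `G` has a paired dominating set of cardinality at most `t + 1`. -/
theorem pairedDominationNumber_le_of_dominating_shortest_path {V : Type*} [Fintype V]
    (G : SimpleGraph V) (hconn : G.Connected) (hcard : 2 ≤ Fintype.card V)
    {x y : V} (p : G.Walk x y) (hpath : p.IsPath) (hshort : p.length = G.dist x y)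
    (t : ℕ) (ht : p.support.length = t)
    (hdom : IsDominating G {v : V | v ∈ p.support}) :
    pairedDominationNumber G ≤ t + 1 ∧
      ∃ D : Finset V, IsPairedDominating G (↑D : Set V) ∧ D.card ≤ t + 1 := by
  have key : ∃ D : Finset V, IsPairedDominating G (↑D : Set V) ∧ D.card ≤ t + 1 := by
    rw [SimpleGraph.Walk.length_support] at ht
    rcases Nat.even_or_odd p.length with he | ho
    · by_cases hw : ∃ w, w ∉ p.support ∧ G.Adj x w
      · obtain ⟨w, hw, hxw⟩ := hw
        obtain ⟨D, hD, hc⟩ := pd_of_odd_path G (SimpleGraph.Walk.cons hxw.symm p)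
          (hpath.cons hw) (by simpa using he.add_one) (by
            intro v
            obtain ⟨u, hu, h⟩ := hdom v
            exact ⟨u, by simpa using Or.inr hu, h⟩)
        exact ⟨D, hD, by simp at hc; omega⟩
      · push Not at hw
        cases p with
        | nil =>
          exfalso
          have : Nontrivial V := Fintype.one_lt_card_iff_nontrivial.mp hcard
          obtain ⟨w, h⟩ := hconn.preconnected.exists_adj_of_nontrivial x
          exact hw w (by simpa using h.ne') h
        | cons h q =>
          rw [SimpleGraph.Walk.cons_isPath_iff] at hpath
          simp only [SimpleGraph.Walk.length_cons] at he ht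
          obtain ⟨D, hD, hc⟩ := pd_of_odd_path G q hpath.1
            (by rwa [Nat.even_add_one, Nat.not_even_iff_odd] at he) (by
              intro v
              by_cases hv : v ∈ q.support
              · exact ⟨v, hv, Or.inl rfl⟩
              by_cases hvx : v = x
              · subst hvx
                exact ⟨_, q.start_mem_support, Or.inr h.symm⟩
              obtain ⟨u, hu, h'⟩ := hdom v
              simp only [SimpleGraph.Walk.support_cons, List.mem_cons, Set.mem_ofPred_eq] at hu
              rcases hu with rfl | hu
              · rcases h' with h' | h'
                · exact absurd h'.symm hvx
                · exact absurd h' (hw v (by simp [hv, hvx]))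
              · exact ⟨u, hu, h'⟩)
          exact ⟨D, hD, by omega⟩
    · obtain ⟨D, hD, hc⟩ := pd_of_odd_path G p hpath ho hdom
      exact ⟨D, hD, by omega⟩
  refine ⟨?_, key⟩
  obtain ⟨D, hD, hc⟩ := key
  have h : pairedDominationNumber G ≤ D.card := by
    unfold pairedDominationNumber
    apply Nat.sInf_le
    exact ⟨D, hD, rfl⟩
  exact h.trans hc
end

section
/- Every finite connected AT-free simple graph G has a dominating pair; that is, there exist vertices x and y of G such that the vertex set of every path between x and y is a dominating set of G. -/
/-- `{a, b, c}` is an asteroidal triple of `G`: three pairwise distinct, pairwise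
nonadjacent vertices such that between any two of them there is a path avoiding the
closed neighborhood of the third. -/
def IsAsteroidalTriple {V : Type*} (G : SimpleGraph V) (a b c : V) : Prop :=
  a ≠ b ∧ a ≠ c ∧ b ≠ c ∧ ¬G.Adj a b ∧ ¬G.Adj a c ∧ ¬G.Adj b c ∧
  (∃ p : G.Walk a b, p.IsPath ∧ ∀ v ∈ p.support, ¬(v = c ∨ G.Adj c v)) ∧
  (∃ p : G.Walk a c, p.IsPath ∧ ∀ v ∈ p.support, ¬(v = b ∨ G.Adj b v)) ∧
  (∃ p : G.Walk b c, p.IsPath ∧ ∀ v ∈ p.support, ¬(v = a ∨ G.Adj a v))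

/-- `G` is AT-free: it contains no asteroidal triple. -/
def ATFree {V : Type*} (G : SimpleGraph V) : Prop :=
  ∀ a b c : V, ¬IsAsteroidalTriple G a b c

/-- `(x, y)` is a dominating pair of `G`: the vertex set of every path between `x`
and `y` is a dominating set of `G`. -/
def IsDominatingPair {V : Type*} (G : SimpleGraph V) (x y : V) : Prop :=
  ∀ p : G.Walk x y, p.IsPath → IsDominating G {v : V | v ∈ p.support}

/-- Closed neighborhood. -/
def clN {V : Type*} (G : SimpleGraph V) (v : V) : Set V := {u | u = v ∨ G.Adj v u}

/-- There is a walk from `a` to `b` inside `A`. -/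
def Cn {V : Type*} (G : SimpleGraph V) (A : Set V) (a b : V) : Prop :=
  ∃ p : G.Walk a b, ∀ v ∈ p.support, v ∈ A

section
variable {V : Type*} {G : SimpleGraph V} {A B : Set V} {a b c : V}

lemma clN_comm : a ∈ clN G b ↔ b ∈ clN G a := by
  simp only [clN, Set.mem_ofPred_eq, G.adj_comm b a, eq_comm]

lemma Cn.left (h : Cn G A a b) : a ∈ A := by
  obtain ⟨p, hp⟩ := h
  exact hp _ p.start_mem_support

lemma Cn.right (h : Cn G A a b) : b ∈ A := by
  obtain ⟨p, hp⟩ := h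
  exact hp _ p.end_mem_support

lemma Cn.refl (h : a ∈ A) : Cn G A a a := ⟨SimpleGraph.Walk.nil, by simpa using h⟩

lemma Cn.symm (h : Cn G A a b) : Cn G A b a := by
  obtain ⟨p, hp⟩ := h
  exact ⟨p.reverse, by simpa using hp⟩

lemma Cn.trans (h : Cn G A a b) (h' : Cn G A b c) : Cn G A a c := by
  obtain ⟨p, hp⟩ := h
  obtain ⟨q, hq⟩ := h'
  refine ⟨p.append q, fun v hv => ?_⟩
  rcases SimpleGraph.Walk.mem_support_append_iff _ _ |>.1 hv with h | h
  · exact hp v h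
  · exact hq v h

lemma Cn.step (h : Cn G A a b) (h' : G.Adj b c) (hc : c ∈ A) : Cn G A a c := by
  refine h.trans ⟨h'.toWalk, ?_⟩
  have := h.right
  intro v hv
  simp at hv
  rcases hv with rfl | rfl <;> assumption

lemma Cn.strengthen (h : Cn G A a b) (hB : ∀ y, Cn G A a y → y ∈ B) : Cn G B a b := by
  classical
  obtain ⟨p, hp⟩ := h
  refine ⟨p, fun v hv => hB v ⟨p.takeUntil v hv, fun u hu => hp u ?_⟩⟩
  exact p.support_takeUntil_subset_support hv hu

lemma Cn.mono (h : Cn G A a b) (hAB : A ⊆ B) : Cn G B a b :=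
  h.strengthen fun _ hy => hAB hy.right

lemma Cn.path (h : Cn G A a b) : ∃ p : G.Walk a b, p.IsPath ∧ ∀ v ∈ p.support, v ∈ A := by
  classical
  obtain ⟨p, hp⟩ := h
  exact ⟨p.bypass, p.bypass_isPath, fun v hv => hp v (p.support_bypass_subset_support hv)⟩

lemma at_of (h1 : Cn G (clN G c)ᶜ a b) (h2 : Cn G (clN G b)ᶜ a c)
    (h3 : Cn G (clN G a)ᶜ b c) : IsAsteroidalTriple G a b c := by
  have e1 := h2.left
  have e2 := h1.left
  have e3 := h1.right
  simp only [clN, Set.mem_compl_iff, Set.mem_ofPred_eq, not_or] at e1 e2 e3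
  exact ⟨e1.1, e2.1, e3.1, fun h => e1.2 h.symm, fun h => e2.2 h.symm, fun h => e3.2 h.symm,
    h1.path, h2.path, h3.path⟩

lemma admissible [Finite V] (hAT : ATFree G) (n : ℕ) : ∀ R : Set V, R.ncard = n → R.Nonempty →
    ∃ x ∈ R, ∀ v w, Cn G (R \ clN G w) x v → Cn G (R \ clN G v) x w → False := by
  induction n using Nat.strong_induction_on with
  | _ n ih =>
  intro R hn hne
  by_cases hex : ∃ x ∈ R, ∃ c ∈ R, c ∉ clN G x
  swap
  · push Not at hex
    obtain ⟨x, hx⟩ := hne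
    refine ⟨x, hx, fun v w h1 h2 => ?_⟩
    exact h2.left.2 (clN_comm.1 (hex x hx v h1.right.1))
  let P : Set (V × V) := {q | q.1 ∈ R ∧ q.2 ∈ R ∧ q.2 ∉ clN G q.1}
  obtain ⟨⟨x, c⟩, ⟨hx, hc, hxc⟩, hmax⟩ := Set.exists_max_image P
    (fun q => {u | Cn G (R \ clN G q.1) q.2 u}.ncard) P.toFinite
    (by obtain ⟨x, hx, c, hc, h⟩ := hex; exact ⟨(x, c), hx, hc, h⟩)
  dsimp only at hx hc hxc hmax
  set C : Set V := {u | Cn G (R \ clN G x) c u} with hC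
  have hcC : c ∈ C := Cn.refl ⟨hc, hxc⟩
  have hCR : ∀ u ∈ C, u ∈ R := fun u hu => hu.right.1
  have hCC : ∀ u ∈ C, Cn G C c u := fun u hu => Cn.strengthen hu fun y hy => hy
  let R' : Set V := {w | w ∈ R ∧ w ∉ C ∧ ∀ u ∈ C, ¬ G.Adj u w}
  have hdis : ∀ w ∈ R', C ⊆ R \ clN G w := by
    rintro w ⟨hw, hwC, hwa⟩ u hu
    refine ⟨hCR u hu, ?_⟩
    rintro (rfl | h)
    · exact hwC hu
    · exact hwa u hu h.symm
  have key : ∀ w ∈ R', ∀ u, Cn G (R \ clN G w) c u → u ∈ C := by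
    intro w hw u hu
    have hsub : C ⊆ {u | Cn G (R \ clN G w) c u} := fun y hy => (hCC y hy).mono (hdis w hw)
    have hle := hmax (w, c) ⟨hw.1, hc, (hdis w hw hcC).2⟩
    rw [Set.eq_of_subset_of_ncard_le hsub hle (Set.toFinite _)]
    exact hu
  have hxR' : x ∈ R' := by
    refine ⟨hx, fun h => h.right.2 (Or.inl rfl), fun u hu h => ?_⟩
    exact (Cn.right hu).2 (Or.inr h.symm)
  have hlt : R'.ncard < R.ncard := by
    refine Set.ncard_lt_ncard ⟨fun u hu => hu.1, fun h => (h hc).2.1 hcC⟩ (Set.toFinite _)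
  obtain ⟨z, hz, hadm⟩ := ih _ (hn ▸ hlt) R' rfl ⟨x, hxR'⟩
  -- vertices next to `C` are adjacent to everything in `R'`
  have hS : ∀ w ∈ R', ∀ y ∈ R, y ∉ C → y ∉ R' → y ∈ clN G w := by
    intro w hw y hy hyC hyR
    by_contra hcon
    have : ∃ u ∈ C, G.Adj u y := by
      by_contra hno
      push Not at hno
      exact hyR ⟨hy, hyC, hno⟩
    obtain ⟨u, hu, huy⟩ := this
    exact hyC (key w hw y (((hCC u hu).mono (hdis w hw)).step huy ⟨hy, hcon⟩))
  have hmix : ∀ w ∈ R', ∀ v ∈ C, ¬ Cn G (R \ clN G w) z v := by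
    intro w hw v hv h
    exact hz.2.1 (key w hw z (((hCC v hv).mono (hdis w hw)).trans h.symm))
  have hstay : ∀ w ∈ R', ∀ v, Cn G (R \ clN G w) z v → Cn G (R' \ clN G w) z v := by
    intro w hw v h
    refine h.strengthen fun y hy => ⟨?_, hy.right.2⟩
    by_contra hyR
    exact hy.right.2 (hS w hw y hy.right.1 (fun hyC => hmix w hw y hyC hy) hyR)
  refine ⟨z, hz.1, fun v w h1 h2 => ?_⟩
  have hv : v ∈ C ∨ v ∈ R' := by
    by_contra hcon
    push Not at hcon
    exact h2.left.2 (clN_comm.1 (hS z hz v h1.right.1 hcon.1 hcon.2))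
  have hw : w ∈ C ∨ w ∈ R' := by
    by_contra hcon
    push Not at hcon
    exact h1.left.2 (clN_comm.1 (hS z hz w h2.right.1 hcon.1 hcon.2))
  rcases hv with hv | hv <;> rcases hw with hw | hw
  · exact hAT z v w (at_of (h1.mono fun _ h => h.2) (h2.mono fun _ h => h.2)
      (((hCC v hv).symm.trans (hCC w hw)).mono fun y hy => (hdis z hz hy).2))
  · exact hmix w hw v hv h1
  · exact hmix v hv w hw h2
  · exact hadm v w (hstay w hw v h1) (hstay v hv w h2)

end

/-- Every finite connected AT-free simple graph has a dominating pair. -/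
theorem atfree_has_dominating_pair {V : Type*} [Fintype V] (G : SimpleGraph V)
    (hconn : G.Connected) (hAT : ATFree G) :
    ∃ x y : V, IsDominatingPair G x y := by
  have := hconn.nonempty
  obtain ⟨x, -, hx⟩ := admissible hAT _ (Set.univ : Set V) rfl Set.univ_nonempty
  have hanti : ∀ v w, Cn G (clN G w)ᶜ x v → Cn G (clN G v)ᶜ x w → False := fun v w h1 h2 =>
    hx v w (h1.mono fun _ h => ⟨trivial, h⟩) (h2.mono fun _ h => ⟨trivial, h⟩)
  have htrans : ∀ u v w, Cn G (clN G u)ᶜ x v → Cn G (clN G v)ᶜ x w → Cn G (clN G u)ᶜ x w := by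
    intro u v w h1 h2
    refine h2.strengthen fun y hy hyu => ?_
    refine hanti v u h1 ?_
    rcases hyu with rfl | h
    · exact hy
    · exact hy.step h.symm fun h => h1.right (clN_comm.1 h)
  obtain ⟨y, -, hy⟩ := Set.exists_min_image (Set.univ : Set V)
    (fun y => {u | Cn G (clN G u)ᶜ x y}.ncard) Set.finite_univ Set.univ_nonempty
  refine ⟨x, y, fun p _ u => ?_⟩
  by_contra hcon
  have hyu : Cn G (clN G u)ᶜ x y := by
    refine ⟨p, fun v hv hvu => hcon ⟨v, hv, ?_⟩⟩
    exact hvu.imp id fun h => h.symm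
  refine absurd (hy u trivial) (not_le.2 (Set.ncard_lt_ncard ⟨?_, ?_⟩ (Set.toFinite _)))
  · intro t ht
    exact htrans t u y ht hyu
  · intro h
    exact (h hyu : Cn G (clN G u)ᶜ x u).right (Or.inl rfl)
end

section
/- Let G be a finite connected AT-free simple graph with a dominating pair (x,y), let d = d_G(x,y), and for each i ≥ 0 let L_i = {w : d_G(x,w) = i}. Then there exists a path P = (x = x_0, x_1, …, x_d = y) in G such that x_i ∈ L_i for each 0 ≤ i ≤ d, and every vertex w with d_G(x,w) = i ≥ 1 is adjacent to x_{i−1} or (when i ≤ d) to x_i. -/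
open SimpleGraph in
lemma spine_geo {V : Type*} (G : SimpleGraph V) (hconn : G.Connected) {x y : V}
    (p : G.Walk x y) (hp : p.length = G.dist x y) (j : ℕ) (hj : j ≤ p.length) :
    G.dist x (p.getVert j) = j := by
  have h1 := G.dist_le (p.take j)
  have h2 := G.dist_le (p.drop j)
  have h3 := hconn.dist_triangle (u := x) (v := p.getVert j) (w := y)
  rw [Walk.take_length] at h1
  rw [Walk.drop_length] at h2
  omega

lemma spine_adj {V : Type*} (G : SimpleGraph V) (hconn : G.Connected) (x : V) {v w : V}
    (h : G.Adj v w) : G.dist x v ≤ G.dist x w + 1 ∧ G.dist x w ≤ G.dist x v + 1 := by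
  have h3 := hconn.dist_triangle (u := x) (v := v) (w := w)
  have h4 := hconn.dist_triangle (u := x) (v := w) (w := v)
  have h5 := SimpleGraph.dist_eq_one_iff_adj.2 h
  have h6 := SimpleGraph.dist_eq_one_iff_adj.2 h.symm
  omega

open SimpleGraph in
lemma spine_down {V : Type*} (G : SimpleGraph V) (hconn : G.Connected) (x u a w : V)
    (i : ℕ) (hu : G.dist x u = i) (hw : G.dist x w = i) (ha : G.dist x a + 1 = i)
    (hua : G.Adj u a) (huw : u ≠ w) (nuw : ¬ G.Adj u w) (naw : ¬ G.Adj a w) :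
    ∃ p : G.Walk u x, p.IsPath ∧ ∀ v ∈ p.support, ¬(v = w ∨ G.Adj w v) := by
  classical
  obtain ⟨q, hq⟩ := hconn.exists_walk_length_eq_dist a x
  let r : G.Walk u x := Walk.cons hua q
  refine ⟨r.bypass, r.bypass_isPath, fun v hv => ?_⟩
  have hv' : v ∈ r.support := r.support_bypass_subset hv
  rw [Walk.support_cons, List.mem_cons] at hv'
  rcases hv' with rfl | hv'
  · rintro (h | h)
    · exact huw h
    · exact nuw h.symm
  · obtain ⟨k, rfl, hk⟩ := Walk.mem_support_iff_exists_getVert.1 hv'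
    have h2 := G.dist_le (q.drop k)
    rw [Walk.drop_length, dist_comm] at h2
    rw [dist_comm] at hq
    rcases Nat.eq_zero_or_pos k with rfl | hk0
    · rw [Walk.getVert_zero]
      rintro (h | h)
      · subst h; omega
      · exact naw h.symm
    · rintro (h | h)
      · rw [h] at h2; omega
      · have := spine_adj G hconn x h
        omega

open SimpleGraph in
lemma spine_at {V : Type*} (G : SimpleGraph V) (hconn : G.Connected) (hAT : ATFree G)
    (x u w u' a b : V) (i : ℕ) (hi : 2 ≤ i)
    (hu : G.dist x u = i) (hw : G.dist x w = i) (hu' : G.dist x u' = i + 1)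
    (ha : G.dist x a + 1 = i) (hb : G.dist x b + 1 = i)
    (hua : G.Adj u a) (hwb : G.Adj w b) (huw : u ≠ w) (nuw : ¬ G.Adj u w)
    (naw : ¬ G.Adj a w) (nbu : ¬ G.Adj b u) (h1 : G.Adj u u') (h2 : G.Adj w u') : False := by
  classical
  have far : ∀ v, 2 ≤ G.dist x v → ¬ (v = x ∨ G.Adj x v) := by
    rintro v hv (rfl | h)
    · simp at hv
    · rw [dist_eq_one_iff_adj.2 h] at hv; omega
  have fu := far u (by omega)
  have fw := far w (by omega)
  have fu' := far u' (by omega)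
  refine hAT u w x ⟨huw, fun h => fu (Or.inl h), fun h => fw (Or.inl h), nuw,
    fun h => fu (Or.inr h.symm), fun h => fw (Or.inr h.symm), ?_,
    spine_down G hconn x u a w i hu hw ha hua huw nuw naw,
    spine_down G hconn x w b u i hw hu hb hwb huw.symm (fun h => nuw h.symm) nbu⟩
  let r : G.Walk u w := Walk.cons h1 (Walk.cons h2.symm Walk.nil)
  refine ⟨r.bypass, r.bypass_isPath, fun v hv => ?_⟩
  have hv' : v ∈ r.support := r.support_bypass_subset hv
  simp only [r, Walk.support_cons, Walk.support_nil, List.mem_cons, List.not_mem_nil,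
    or_false] at hv'
  rcases hv' with rfl | rfl | rfl <;> assumption

open SimpleGraph in
lemma spine_dom {V : Type*} (G : SimpleGraph V) (hconn : G.Connected) (x y : V)
    (hdp : IsDominatingPair G x y) (p : G.Walk x y) (hp : p.length = G.dist x y) (w : V) :
    ∃ j ≤ G.dist x y, (p.getVert j = w ∨ G.Adj (p.getVert j) w) ∧
      G.dist x w ≤ j + 1 ∧ j ≤ G.dist x w + 1 := by
  obtain ⟨v, hv, h⟩ := hdp p (p.isPath_of_length_eq_dist hp) w
  obtain ⟨j, rfl, hj⟩ := Walk.mem_support_iff_exists_getVert.1 hv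
  refine ⟨j, by omega, h, ?_⟩
  have hg := spine_geo G hconn p hp j hj
  rcases h with h | h
  · rw [h] at hg; omega
  · have := spine_adj G hconn x h
    omega

open SimpleGraph in
lemma spine_dom2 {V : Type*} (G : SimpleGraph V) (hconn : G.Connected) (x y : V)
    (hdp : IsDominatingPair G x y) (u : V) (q : G.Walk u y) (i : ℕ)
    (hq : q.length + i = G.dist x y) (hu : G.dist x u = i) (a w : V) (hua : G.Adj u a)
    (ha : G.dist x a + 1 = i) (hw : G.dist x w = i) (huw : w ≠ u) (nuw : ¬ G.Adj u w)
    (naw : ¬ G.Adj a w) : 1 ≤ q.length ∧ G.Adj (q.getVert 1) w := by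
  obtain ⟨r, hr⟩ := hconn.exists_walk_length_eq_dist x a
  let p : G.Walk x y := r.append (Walk.cons hua.symm q)
  have hp : p.length = G.dist x y := by
    simp only [p, Walk.length_append, Walk.length_cons]; omega
  obtain ⟨j, hj, h, h1, h2⟩ := spine_dom G hconn x y hdp p hp w
  have hg : p.getVert j = (Walk.cons hua.symm q).getVert (j - r.length) := by
    simp only [p]
    rw [Walk.getVert_append, if_neg (by omega)]
  rw [hg] at h
  obtain h0 | h0 | h0 : j - r.length = 0 ∨ j - r.length = 1 ∨ j - r.length = 2 := by omega
  · rw [h0, Walk.getVert_zero] at h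
    rcases h with rfl | h
    · omega
    · exact absurd h naw
  · rw [h0, Walk.getVert_cons_succ, Walk.getVert_zero] at h
    rcases h with h | h
    · exact absurd h.symm huw
    · exact absurd h nuw
  · have hgeo := spine_geo G hconn p hp j (by omega)
    rw [hg] at hgeo
    rw [h0, Walk.getVert_cons_succ] at h hgeo
    refine ⟨by omega, ?_⟩
    rcases h with h | h
    · rw [h] at hgeo; omega
    · exact h

open SimpleGraph in
lemma spine_main {V : Type*} [Fintype V] (G : SimpleGraph V)
    (hconn : G.Connected) (hAT : ATFree G) (x y : V) (hdp : IsDominatingPair G x y)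
    (k : ℕ) : ∀ i : ℕ, k + i = G.dist x y →
    ∃ (u : V) (q : G.Walk u y), q.length = k ∧ G.dist x u = i ∧
      (∀ w a : V, G.dist x w = i → w ≠ u → ¬ G.Adj u w → G.Adj u a → G.dist x a + 1 = i →
        G.Adj a w) ∧
      (∀ w : V, ∀ j : ℕ, i < j → G.dist x w = j →
        G.Adj (q.getVert (j - 1 - i)) w ∨ (j ≤ G.dist x y ∧ G.Adj (q.getVert (j - i)) w)) := by
  classical
  induction k with
  | zero =>
    intro i hi
    refine ⟨y, Walk.nil, rfl, by omega, ?_, ?_⟩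
    · intro w a hw hwy nyw hya ha
      by_contra naw
      have := spine_dom2 G hconn x y hdp y Walk.nil i (by simpa using hi) (by omega) a w hya ha
        hw hwy nyw naw
      simp at this
    · intro w j hj hw
      left
      obtain ⟨p, hp⟩ := hconn.exists_walk_length_eq_dist x y
      obtain ⟨l, hl, h, h1, h2⟩ := spine_dom G hconn x y hdp p hp w
      have : l = p.length := by omega
      rw [this, Walk.getVert_length] at h
      rcases h with rfl | h
      · omega
      · simpa using h
  | succ k ih =>
    intro i hi
    obtain ⟨u', q, hq, hu', hC, hlev⟩ := ih (i + 1) (by omega)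
    let D : V → Finset V := fun v => Finset.univ.filter fun a => G.Adj v a ∧ G.dist x a + 1 = i
    let C : Finset V := Finset.univ.filter fun v => G.Adj u' v ∧ G.dist x v = i
    have hne : C.Nonempty := by
      obtain ⟨r, hr⟩ := hconn.exists_walk_length_eq_dist x u'
      refine ⟨r.getVert i, ?_⟩
      simp only [C, Finset.mem_filter, Finset.mem_univ, true_and]
      refine ⟨?_, spine_geo G hconn r hr i (by omega)⟩
      have := r.adj_getVert_succ (i := i) (by omega)
      rw [show i + 1 = r.length by omega, Walk.getVert_length] at this
      exact this.symm
    obtain ⟨u, huC, hmin⟩ := Finset.exists_min_image C (fun v => (D v).card) hne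
    simp only [C, Finset.mem_filter, Finset.mem_univ, true_and] at huC hmin
    obtain ⟨hadj, hu⟩ := huC
    refine ⟨u, Walk.cons hadj.symm q, by simp [hq], hu, ?_, ?_⟩
    · intro w a hw hwu nuw hua ha
      by_contra naw
      have h1 := (spine_dom2 G hconn x y hdp u (Walk.cons hadj.symm q) i
        (by simp only [Walk.length_cons]; omega) hu a w hua ha hw hwu nuw naw).2
      rw [Walk.getVert_cons_succ, Walk.getVert_zero] at h1
      have h2 : 2 ≤ i := by
        by_contra hlt
        have : G.dist x a = 0 := by omega
        have hxa : x = a := (hconn.dist_eq_zero_iff).1 this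
        subst hxa
        exact naw (dist_eq_one_iff_adj.1 (by omega))
      have hsub : D w ⊆ D u := by
        intro b hb
        simp only [D, Finset.mem_filter, Finset.mem_univ, true_and] at hb ⊢
        refine ⟨?_, hb.2⟩
        by_contra nub
        exact spine_at G hconn hAT x u w u' a b i h2 hu hw hu' ha hb.2 hua hb.1 hwu.symm nuw naw
          (fun h => nub h.symm) hadj.symm h1.symm
      have hss : D w ⊂ D u := by
        refine Finset.ssubset_iff_of_subset hsub |>.2 ⟨a, ?_, ?_⟩
        · simp [D, hua, ha]
        · simp only [D, Finset.mem_filter, Finset.mem_univ, true_and]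
          exact fun h => naw h.1.symm
      have := Finset.card_lt_card hss
      have := hmin w ⟨h1, hw⟩
      omega
    · intro w j hj hw
      rcases Nat.lt_or_ge (i + 1) j with h | h
      · have := hlev w j h hw
        rw [show j - 1 - i = (j - 1 - (i + 1)) + 1 by omega,
          show j - i = (j - (i + 1)) + 1 by omega, Walk.getVert_cons_succ,
          Walk.getVert_cons_succ]
        exact this
      · obtain rfl : j = i + 1 := by omega
        rw [show i + 1 - 1 - i = 0 by omega, show i + 1 - i = 0 + 1 by omega,
          Walk.getVert_cons_succ, Walk.getVert_zero, Walk.getVert_zero]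
        by_cases hwu : w = u'
        · left; rw [hwu]; exact hadj.symm
        by_cases hadjw : G.Adj u' w
        · right; exact ⟨by omega, hadjw⟩
        · left
          exact hC w u hw hwu hadjw hadj (by omega)

/-- Let `G` be a finite connected AT-free simple graph with a dominating pair `(x, y)`
and let `d = d_G(x, y)`.  Then there is a path `P = (x = x₀, x₁, …, x_d = y)` such that
`xᵢ` is at distance `i` from `x` for each `0 ≤ i ≤ d`, and every vertex `w` with
`d_G(x, w) = i ≥ 1` is adjacent to `x_{i-1}` or (when `i ≤ d`) to `xᵢ`. -/
theorem atfree_bfs_spine {V : Type*} [Fintype V] (G : SimpleGraph V)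
    (hconn : G.Connected) (hAT : ATFree G) (x y : V) (hdp : IsDominatingPair G x y)
    (d : ℕ) (hd : d = G.dist x y) :
    ∃ p : G.Walk x y, p.IsPath ∧ p.length = d ∧
      (∀ i : ℕ, i ≤ d → G.dist x (p.getVert i) = i) ∧
      (∀ w : V, ∀ i : ℕ, 1 ≤ i → G.dist x w = i →
        G.Adj (p.getVert (i - 1)) w ∨ (i ≤ d ∧ G.Adj (p.getVert i) w)) := by
  subst hd
  obtain ⟨u, q, hq, hu, -, hlev⟩ :=
    spine_main G hconn hAT x y hdp (G.dist x y) 0 (by omega)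
  obtain rfl : x = u := hconn.dist_eq_zero_iff.1 hu
  refine ⟨q, q.isPath_of_length_eq_dist hq, hq,
    fun i hi => spine_geo G hconn q hq i (by omega), fun w i hi hw => ?_⟩
  simpa using hlev w i hi hw
end

section
/- Let G be a finite connected AT-free simple graph with no isolated vertices and with a dominating pair (x,y). For each i ≥ 0 let L_i = {w : d_G(x,w) = i}, and let l be the largest index with L_l nonempty. Then there exists a paired dominating set D_p of G of minimum cardinality (|D_p| = γ_pr(G)) such that |D_p ∩ (L_i ∪ L_{i+1} ∪ ⋯ ∪ L_{i+j})| ≤ j + 4 for all i ∈ {0, 1, …, l} and all j ∈ {0, 1, …, l − i}. -/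
/-- A finite set carries a fixed-point-free adjacency involution. -/
def Mt {V : Type*} (G : SimpleGraph V) (D : Finset V) (σ : V → V) : Prop :=
  ∀ v ∈ D, σ v ∈ D ∧ σ (σ v) = v ∧ G.Adj v (σ v)

def Cov {V : Type*} (G : SimpleGraph V) (D : Finset V) (v : V) : Prop :=
  ∃ u ∈ D, u = v ∨ G.Adj u v

lemma mt_iff {V : Type*} (G : SimpleGraph V) (D : Finset V) :
    (∃ M : G.Subgraph, M.verts = (↑D : Set V) ∧ M.IsMatching) ↔ ∃ σ, Mt G D σ := by
  classical
  constructor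
  · rintro ⟨M, hv, hM⟩
    have h : ∀ v, ∃ w, v ∈ D → M.Adj v w := by
      intro v
      by_cases hd : v ∈ D
      · obtain ⟨w, hw, -⟩ := hM (v := v) (by rw [hv]; exact hd)
        exact ⟨w, fun _ => hw⟩
      · exact ⟨v, fun h => absurd h hd⟩
    choose σ hσ using h
    refine ⟨σ, fun v hd => ?_⟩
    have h1 := hσ v hd
    have h2 : σ v ∈ D := by
      have := M.edge_vert h1.symm
      rw [hv] at this; exact this
    refine ⟨h2, ?_, h1.adj_sub⟩
    obtain ⟨w, hw, hu⟩ := hM (v := σ v) (by rw [hv]; exact h2)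
    rw [hu _ (hσ _ h2), hu _ h1.symm]
  · rintro ⟨σ, h⟩
    refine ⟨{ verts := D, Adj := fun v w => v ∈ D ∧ w = σ v, adj_sub := ?_, edge_vert := ?_, symm := ?_ }, rfl, ?_⟩
    · rintro v w ⟨hv, rfl⟩; exact (h v hv).2.2
    · rintro v w ⟨hv, rfl⟩; exact hv
    · constructor
      rintro v w ⟨hv, rfl⟩; exact ⟨(h v hv).1, (h v hv).2.1.symm⟩
    · intro v hv
      exact ⟨σ v, ⟨hv, rfl⟩, fun w hw => hw.2⟩

lemma mt_even {V : Type*} [Fintype V] (G : SimpleGraph V) (D : Finset V) (σ : V → V) (h : Mt G D σ) :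
    Even D.card := by
  classical
  obtain ⟨M, hv, hM⟩ := (mt_iff G D).2 ⟨σ, h⟩
  have := hM.even_card
  rw [Set.toFinset_card] at this
  have e : Fintype.card M.verts = D.card := by
    rw [← Nat.card_eq_fintype_card, hv]; simp
  rwa [e] at this

lemma mt_pair {V : Type*} [DecidableEq V] (G : SimpleGraph V) (D : Finset V) (σ : V → V) (h : Mt G D σ)
    (u v : V) (hu : u ∉ D) (hv : v ∉ D) (a : G.Adj u v) :
    ∃ τ, Mt G (insert u (insert v D)) τ := by
  have hne := a.ne
  refine ⟨fun z => if z = u then v else if z = v then u else σ z, ?_⟩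
  intro z hz
  simp only [Finset.mem_insert] at hz
  by_cases h1 : z = u
  · subst h1; simp [hne.symm, a]
  by_cases h2 : z = v
  · subst h2; simp [hne.symm, a.symm]
  have hz : z ∈ D := by tauto
  obtain ⟨p, q, r⟩ := h z hz
  have h3 : σ z ≠ u := fun e => hu (e ▸ p)
  have h4 : σ z ≠ v := fun e => hv (e ▸ p)
  simp [h1, h2, h3, h4, p, q, r]

lemma mt_erase {V : Type*} [DecidableEq V] (G : SimpleGraph V) (D : Finset V) (σ : V → V) (h : Mt G D σ)
    (w : V) (hw : w ∈ D) : Mt G ((D.erase w).erase (σ w)) σ := by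
  intro z hz
  simp only [Finset.mem_erase] at hz ⊢
  obtain ⟨h1, h2, h3⟩ := hz
  obtain ⟨p, q, r⟩ := h z h3
  refine ⟨⟨fun e => h2 ?_, fun e => h1 ?_, p⟩, q, r⟩
  · rw [← q, e, (h w hw).2.1]
  · rw [← q, e]

lemma mt_card {V : Type*} [DecidableEq V] (G : SimpleGraph V) (D : Finset V) (σ : V → V) (h : Mt G D σ)
    (w : V) (hw : w ∈ D) : ((D.erase w).erase (σ w)).card + 2 = D.card := by
  obtain ⟨p, q, r⟩ := h w hw
  have h1 : σ w ∈ D.erase w := Finset.mem_erase.2 ⟨r.ne.symm, p⟩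
  have h2 := Finset.card_erase_add_one h1
  have h3 := Finset.card_erase_add_one hw
  omega

lemma add_one {V : Type*} [DecidableEq V] (G : SimpleGraph V) (D : Finset V) (σ : V → V) (h : Mt G D σ)
    (v w : V) (hv : v ∉ D) (hvw : G.Adj v w) :
    (∃ e, e ∉ D ∧ e ≠ v ∧ (∃ τ, Mt G (insert v (insert e D)) τ) ∧
      (G.Adj v e ∨ (w ∈ D ∧ G.Adj (σ w) e))) ∨
    (∃ D' : Finset V, (∃ τ, Mt G D' τ) ∧ D'.card ≤ D.card ∧
      ∀ u, Cov G (insert v D) u → Cov G D' u) := by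
  by_cases h1 : ∃ e, G.Adj v e ∧ e ∉ D
  · obtain ⟨e, he, hd⟩ := h1
    exact Or.inl ⟨e, hd, he.ne.symm, mt_pair G D σ h v e hv hd he, Or.inl he⟩
  push Not at h1
  have hw := h1 w hvw
  obtain ⟨p, q, r⟩ := h w hw
  have hE := mt_erase G D σ h w hw
  have hvE : v ∉ (D.erase w).erase (σ w) := by simp [hv]
  obtain ⟨τ, hτ⟩ := mt_pair G _ σ hE v w hvE (by simp) hvw
  by_cases h2 : ∃ e, G.Adj (σ w) e ∧ e ∉ D ∧ e ≠ v
  · obtain ⟨e, he, hd, hev⟩ := h2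
    left
    refine ⟨e, hd, hev, ?_, Or.inr ⟨hw, he⟩⟩
    obtain ⟨τ', hτ'⟩ := mt_pair G _ τ hτ (σ w) e
      (by simp [r.ne.symm]; rintro e1; exact hv (e1 ▸ p))
      (by simp [hd, hev]; rintro rfl; exact hd hw) he
    refine ⟨τ', ?_⟩
    convert hτ' using 1
    ext z
    simp only [Finset.mem_insert, Finset.mem_erase]
    by_cases hz1 : z = w
    · subst hz1; simp [hw]
    by_cases hz2 : z = σ w
    · subst hz2; simp [p]
    tauto
  · push Not at h2
    right
    refine ⟨_, ⟨τ, hτ⟩, ?_, ?_⟩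
    · have := mt_card G D σ h w hw
      have a1 := Finset.card_insert_le v (insert w ((D.erase w).erase (σ w)))
      have a2 := Finset.card_insert_le w ((D.erase w).erase (σ w))
      omega
    · have key : ∀ u, u = v ∨ u ∈ D → Cov G (insert v (insert w ((D.erase w).erase (σ w)))) u := by
        intro u hu
        by_cases e2 : u = σ w
        · exact ⟨w, by simp, Or.inr (e2 ▸ r)⟩
        · refine ⟨u, ?_, Or.inl rfl⟩
          simp only [Finset.mem_insert, Finset.mem_erase]
          tauto
      rintro u ⟨z, hz, hzu⟩
      rcases hzu with rfl | hzu
      · exact key _ (by simpa using hz)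
      · by_cases e1 : z = σ w
        · subst e1
          apply key
          by_contra hc
          push Not at hc
          exact hc.1 (h2 u hzu hc.2)
        · refine ⟨z, ?_, Or.inr hzu⟩
          simp only [Finset.mem_insert, Finset.mem_erase] at hz ⊢
          tauto

lemma cov_mono {V : Type*} (G : SimpleGraph V) {D E : Finset V} (h : D ⊆ E) {u : V} (hc : Cov G D u) :
    Cov G E u := by
  obtain ⟨z, hz, h1⟩ := hc
  exact ⟨z, h hz, h1⟩

lemma add_one' {V : Type*} [DecidableEq V] (G : SimpleGraph V) (hiso : ∀ v : V, ∃ u : V, G.Adj v u)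
    (D : Finset V) (h : ∃ σ, Mt G D σ) (v : V) :
    ∃ D' : Finset V, (∃ τ, Mt G D' τ) ∧ D'.card ≤ D.card + 2 ∧
      ∀ u, Cov G (insert v D) u → Cov G D' u := by
  by_cases hv : v ∈ D
  · exact ⟨D, h, by omega, fun u hu => by rwa [Finset.insert_eq_of_mem hv] at hu⟩
  obtain ⟨σ, h⟩ := h
  obtain ⟨w, hw⟩ := hiso v
  rcases add_one G D σ h v w hv hw with ⟨e, he, hev, ht, -⟩ | ⟨D', h1, h2, h3⟩
  · refine ⟨_, ht, ?_, fun u hu => cov_mono G ?_ hu⟩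
    · have a1 := Finset.card_insert_le v (insert e D)
      have a2 := Finset.card_insert_le e D
      omega
    · exact Finset.insert_subset_insert _ (Finset.subset_insert _ _)
  · exact ⟨D', h1, by omega, h3⟩

lemma add_two {V : Type*} [DecidableEq V] (G : SimpleGraph V) (hiso : ∀ v : V, ∃ u : V, G.Adj v u)
    (D : Finset V) (h : ∃ σ, Mt G D σ) (v w : V) (hvw : G.Adj v w) :
    ∃ D' : Finset V, (∃ τ, Mt G D' τ) ∧ D'.card ≤ D.card + 2 ∧
      ∀ u, Cov G (insert v (insert w D)) u → Cov G D' u := by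
  by_cases hv : v ∈ D
  · obtain ⟨D', h1, h2, h3⟩ := add_one' G hiso D h w
    refine ⟨D', h1, h2, fun u hu => h3 u ?_⟩
    rwa [Finset.insert_eq_of_mem (Finset.mem_insert_of_mem hv)] at hu
  by_cases hw : w ∈ D
  · obtain ⟨D', h1, h2, h3⟩ := add_one' G hiso D h v
    refine ⟨D', h1, h2, fun u hu => h3 u ?_⟩
    rwa [Finset.insert_eq_of_mem hw] at hu
  obtain ⟨σ, h⟩ := h
  refine ⟨_, mt_pair G D σ h v w hv hw hvw, ?_, fun u hu => hu⟩
  have a1 := Finset.card_insert_le v (insert w D)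
  have a2 := Finset.card_insert_le w D
  omega

lemma cov_insert_of {V : Type*} [DecidableEq V] (G : SimpleGraph V) {D E : Finset V}
    (h : ∀ u, Cov G D u → Cov G E u) {v u : V} (hc : Cov G (insert v D) u) : Cov G (insert v E) u := by
  obtain ⟨z, hz, h1⟩ := hc
  rcases Finset.mem_insert.1 hz with rfl | hz
  · exact ⟨z, by simp, h1⟩
  · exact cov_mono G (Finset.subset_insert _ _) (h u ⟨z, hz, h1⟩)

/-- Cheaply add a path segment. -/
lemma add_path {V : Type*} [DecidableEq V] (G : SimpleGraph V) (hiso : ∀ v : V, ∃ u : V, G.Adj v u)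
    (d : ℕ) (f : ℕ → V) (hf : ∀ k < d, G.Adj (f k) (f (k+1))) :
    ∀ (m n s : ℕ), n ≤ 2 * m → s + n ≤ d + 1 → ∀ (D : Finset V), (∃ σ, Mt G D σ) →
    ∃ D' : Finset V, (∃ τ, Mt G D' τ) ∧ D'.card ≤ D.card + 2 * m ∧
      ∀ u, Cov G (D ∪ (Finset.Ico s (s+n)).image f) u → Cov G D' u := by
  intro m
  induction m with
  | zero =>
    intro n s hn hs D hD
    have : n = 0 := by omega
    subst this
    exact ⟨D, hD, by omega, fun u hu => by simpa using hu⟩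
  | succ m ih =>
    intro n s hn hs D hD
    rcases n with _ | _ | n
    · exact ⟨D, hD, by omega, fun u hu => by simpa using hu⟩
    · obtain ⟨D', h1, h2, h3⟩ := add_one' G hiso D hD (f s)
      refine ⟨D', h1, by omega, fun u hu => h3 u ?_⟩
      refine cov_mono G ?_ hu
      intro z; simp
    · obtain ⟨D', h1, h2, h3⟩ := ih n (s+2) (by omega) (by omega) D hD
      obtain ⟨D2, g1, g2, g3⟩ := add_two G hiso D' h1 (f s) (f (s+1)) (hf s (by omega))
      refine ⟨D2, g1, by omega, fun u hu => g3 u ?_⟩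
      apply cov_insert_of G (fun u hu => cov_insert_of G h3 hu)
      refine cov_mono G ?_ hu
      intro z
      simp only [Finset.mem_union, Finset.mem_image, Finset.mem_Ico, Finset.mem_insert]
      rintro (hz | ⟨k, hk, rfl⟩)
      · tauto
      · by_cases k1 : k = s
        · left; rw [k1]
        by_cases k2 : k = s + 1
        · right; left; rw [k2]
        right; right; right
        exact ⟨k, by omega, rfl⟩

/-- Exactly add a disjoint path segment of even size. -/
lemma add_path_exact {V : Type*} [DecidableEq V] (G : SimpleGraph V) 
    (d : ℕ) (f : ℕ → V) (hf : ∀ k < d, G.Adj (f k) (f (k+1)))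
    (hinj : ∀ k ≤ d, ∀ k' ≤ d, f k = f k' → k = k') (D : Finset V) (hD : ∃ σ, Mt G D σ) :
    ∀ (m s : ℕ), s + 2 * m ≤ d + 1 → (∀ k, s ≤ k → k < s + 2 * m → f k ∉ D) →
    ∃ τ, Mt G (D ∪ (Finset.Ico s (s+2*m)).image f) τ := by
  intro m
  induction m with
  | zero => intro s _ _; simpa using hD
  | succ m ih =>
    intro s hs hk
    obtain ⟨τ, h⟩ := ih (s+2) (by omega) (fun k h1 h2 => hk k (by omega) (by omega))
    have := mt_pair G _ τ h (f s) (f (s+1)) ?_ ?_ (hf s (by omega))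
    · obtain ⟨τ', h'⟩ := this
      refine ⟨τ', ?_⟩
      convert h' using 1
      ext z
      simp only [Finset.mem_union, Finset.mem_image, Finset.mem_Ico, Finset.mem_insert]
      constructor
      · rintro (hz | ⟨k, hk, rfl⟩)
        · tauto
        · by_cases k1 : k = s
          · left; rw [k1]
          by_cases k2 : k = s + 1
          · right; left; rw [k2]
          right; right; right
          exact ⟨k, by omega, rfl⟩
      · rintro (rfl | rfl | hz | ⟨k, hk, rfl⟩)
        · right; exact ⟨s, by omega, rfl⟩
        · right; exact ⟨s+1, by omega, rfl⟩
        · tauto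
        · right; exact ⟨k, by omega, rfl⟩
    · simp only [Finset.mem_union, Finset.mem_image, Finset.mem_Ico, not_or, not_exists, not_and]
      refine ⟨hk s (by omega) (by omega), fun k h1 h2 => ?_⟩
      have := hinj k (by omega) s (by omega) h2
      omega
    · simp only [Finset.mem_union, Finset.mem_image, Finset.mem_Ico, not_or, not_exists, not_and]
      refine ⟨hk _ (by omega) (by omega), fun k h1 h2 => ?_⟩
      have := hinj k (by omega) (s+1) (by omega) h2
      omega

lemma dist_adj {V : Type*} (G : SimpleGraph V) (hconn : G.Connected) (x : V) {u v : V} (h : G.Adj u v) :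
    G.dist x u ≤ G.dist x v + 1 ∧ G.dist x v ≤ G.dist x u + 1 := by
  have h1 := hconn.dist_triangle (u := x) (v := u) (w := v)
  have h2 := hconn.dist_triangle (u := x) (v := v) (w := u)
  rw [SimpleGraph.dist_eq_one_iff_adj.2 h] at h1
  rw [SimpleGraph.dist_eq_one_iff_adj.2 h.symm] at h2
  omega

lemma exists_pred {V : Type*} (G : SimpleGraph V) (hconn : G.Connected) (x w : V) (h : G.dist x w ≠ 0) :
    ∃ u, G.Adj u w ∧ G.dist x u + 1 = G.dist x w := by
  obtain ⟨p, hp⟩ := hconn.exists_walk_length_eq_dist x w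
  have hnn : ¬ p.Nil := by
    intro hn
    have := SimpleGraph.Walk.length_eq_zero_iff.2 hn
    omega
  refine ⟨p.penultimate, p.adj_penultimate hnn, ?_⟩
  have h1 := (dist_adj G hconn x (p.adj_penultimate hnn)).2
  have h2 := SimpleGraph.dist_le p.dropLast
  have h3 : p.dropLast.length + 1 = p.length := by
    simp [SimpleGraph.Walk.dropLast]; omega
  omega

lemma down_walk {V : Type*} (G : SimpleGraph V) (hconn : G.Connected) (x : V) :
    ∀ (n : ℕ) (u : V), G.dist x u = n → ∃ p : G.Walk x u, ∀ w ∈ p.support, w = u ∨ G.dist x w < n := by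
  intro n
  induction n with
  | zero =>
    intro u hu
    have : x = u := hconn.dist_eq_zero_iff.1 hu
    subst this
    exact ⟨.nil, by simp⟩
  | succ n ih =>
    intro u hu
    obtain ⟨z, hz, hd⟩ := exists_pred G hconn x u (by omega)
    obtain ⟨p, hp⟩ := ih z (by omega)
    refine ⟨p.concat hz, ?_⟩
    intro w hw
    rw [SimpleGraph.Walk.support_concat] at hw
    simp at hw
    rcases hw with hw | hw
    · rcases hp w hw with rfl | h
      · right; omega
      · right; omega
    · left; exact hw

lemma at_lemma {V : Type*} (G : SimpleGraph V) (hconn : G.Connected) (hAT : ATFree G) (x u v t a b : V)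
    (k : ℕ) (hu : G.dist x u = k + 2) (hv : G.dist x v = k + 2) (hut : G.Adj u t) (hvt : G.Adj v t)
    (ht : k + 2 ≤ G.dist x t) (hne : u ≠ v) (hn : ¬ G.Adj u v)
    (ha : G.Adj a u) (hda : G.dist x a = k + 1) (hav : ¬ G.Adj a v)
    (hb : G.Adj b v) (hdb : G.dist x b = k + 1) (hbu : ¬ G.Adj b u) : False := by
  classical
  have hx0 : G.dist x x = 0 := by simp
  have side : ∀ (u v a : V), G.dist x u = k+2 → G.dist x v = k+2 → u ≠ v → ¬ G.Adj u v → G.Adj a u →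
      G.dist x a = k+1 → ¬ G.Adj a v →
      ∃ p : G.Walk x u, p.IsPath ∧ ∀ z ∈ p.support, ¬(z = v ∨ G.Adj v z) := by
    intro u v a hu hv hne hn ha hda hav
    obtain ⟨p, hp⟩ := down_walk G hconn x _ a hda
    refine ⟨(p.concat ha).bypass, SimpleGraph.Walk.bypass_isPath _, ?_⟩
    intro z hz
    have hz := SimpleGraph.Walk.support_bypass_subset_support _ hz
    rw [SimpleGraph.Walk.support_concat] at hz
    simp at hz
    rintro (rfl | hadj)
    · rcases hz with hz | hz
      · rcases hp z hz with rfl | h <;> omega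
      · exact hne hz.symm
    · rcases hz with hz | rfl
      · rcases hp z hz with rfl | h
        · exact hav hadj.symm
        · have := dist_adj G hconn x hadj
          omega
      · exact hn hadj.symm
  have hfar : ∀ z, k + 2 ≤ G.dist x z → ¬ (z = x ∨ G.Adj x z) := by
    rintro z hz (rfl | h)
    · omega
    · have := dist_adj G hconn x h
      omega
  apply hAT x u v
  refine ⟨?_, ?_, hne, ?_, ?_, hn, ?_, ?_, ?_⟩
  · rintro rfl; omega
  · rintro rfl; omega
  · intro h; exact hfar u (by omega) (Or.inr h)
  · intro h; exact hfar v (by omega) (Or.inr h)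
  · exact side u v a hu hv hne hn ha hda hav
  · exact side v u b hv hu hne.symm (fun h => hn h.symm) hb hdb hbu
  · let q : G.Walk u v := .cons hut (.cons hvt.symm .nil)
    refine ⟨q.bypass, SimpleGraph.Walk.bypass_isPath _, ?_⟩
    intro z hz
    have hz := SimpleGraph.Walk.support_bypass_subset_support _ hz
    simp [q] at hz
    apply hfar
    rcases hz with rfl | rfl | rfl <;> omega

lemma good_path {V : Type*} [Fintype V] (G : SimpleGraph V)
    (hconn : G.Connected) (hAT : ATFree G) (x y : V) (hdp : IsDominatingPair G x y) :
    ∃ (d : ℕ) (f : ℕ → V), (∀ k < d, G.Adj (f k) (f (k+1))) ∧ (∀ k ≤ d, G.dist x (f k) = k) ∧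
      ∀ v, ∃ m ≤ d, (f m = v ∨ G.Adj (f m) v) ∧ m ≤ G.dist x v ∧ G.dist x v ≤ m + 1 := by
  classical
  let dn : V → Finset V := fun u => Finset.univ.filter (fun z => G.Adj z u ∧ G.dist x z + 1 = G.dist x u)
  have hpred : ∀ w, ∃ u, G.dist x w ≠ 0 → u ∈ dn w ∧ ∀ u' ∈ dn w, (dn u).card ≤ (dn u').card := by
    intro w
    by_cases hw : G.dist x w = 0
    · exact ⟨w, fun h => absurd hw h⟩
    obtain ⟨u0, h1, h2⟩ := exists_pred G hconn x w hw
    obtain ⟨u, hu, hm⟩ := Finset.exists_min_image (dn w) (fun u => (dn u).card) ⟨u0, by simp [dn, h1, h2]⟩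
    exact ⟨u, fun _ => ⟨hu, hm⟩⟩
  choose pr hpr using hpred
  let d := G.dist x y
  let f : ℕ → V := fun k => pr^[d - k] y
  have hstep : ∀ k < d, f k = pr (f (k+1)) := by
    intro k hk
    have : d - k = (d - (k+1)) + 1 := by omega
    simp only [f]
    rw [this, Function.iterate_succ_apply']
  have hfd : f d = y := by simp [f]
  have hdist' : ∀ j ≤ d, G.dist x (f (d - j)) = d - j := by
    intro j
    induction j with
    | zero => intro _; simp [hfd]; rfl
    | succ j ih =>
      intro hj
      have h1 := ih (by omega)
      have h2 := hstep (d - (j+1)) (by omega)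
      have e : d - (j+1) + 1 = d - j := by omega
      rw [e] at h2
      have h3 := (hpr (f (d-j)) (by omega)).1
      rw [← h2] at h3
      simp [dn] at h3
      have := h3.2
      omega
  have hdist : ∀ k ≤ d, G.dist x (f k) = k := by
    intro k hk
    have := hdist' (d - k) (by omega)
    rwa [show d - (d - k) = k by omega] at this
  have hdn : ∀ k < d, f k ∈ dn (f (k+1)) ∧ ∀ u' ∈ dn (f (k+1)), (dn (f k)).card ≤ (dn u').card := by
    intro k hk
    have := hpr (f (k+1)) (by rw [hdist _ (by omega)]; omega)
    rwa [← hstep k hk] at this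
  have hadj : ∀ k < d, G.Adj (f k) (f (k+1)) := by
    intro k hk
    have := (hdn k hk).1
    simp [dn] at this
    exact this.1
  have hf0 : f 0 = x := (hconn.dist_eq_zero_iff.1 (hdist 0 (by omega))).symm
  have hwalk : ∀ k ≤ d, ∃ p : G.Walk x (f k), p.length = k ∧ ∀ v ∈ p.support, ∃ m ≤ k, v = f m := by
    intro k
    induction k with
    | zero =>
      intro _
      rw [hf0]
      exact ⟨.nil, by simp, by simp [hf0]⟩
    | succ k ih =>
      intro hk
      obtain ⟨p, h1, h2⟩ := ih (by omega)
      refine ⟨p.concat (hadj k (by omega)), by simp [h1], ?_⟩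
      intro v hv
      rw [SimpleGraph.Walk.support_concat] at hv
      simp at hv
      rcases hv with hv | hv
      · obtain ⟨m, hm, e⟩ := h2 v hv
        exact ⟨m, by omega, e⟩
      · exact ⟨k+1, le_refl _, hv⟩
  refine ⟨d, f, hadj, hdist, ?_⟩
  intro v
  have hw := hwalk d le_rfl
  rw [hfd] at hw
  obtain ⟨p, hp, hs⟩ := hw
  obtain ⟨z, hz, hzv⟩ := hdp p (SimpleGraph.Walk.isPath_of_length_eq_dist p hp) v
  obtain ⟨m, hm, rfl⟩ := hs z hz
  have hdm := hdist m hm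
  rcases hzv with rfl | hzv
  · exact ⟨m, hm, Or.inl rfl, by omega, by omega⟩
  have hd1 := dist_adj G hconn x hzv
  by_cases hc : m ≤ G.dist x v
  · exact ⟨m, hm, Or.inr hzv, by omega, by omega⟩
  obtain ⟨k, rfl⟩ : ∃ k, m = k + 1 := ⟨m - 1, by omega⟩
  have hdv : G.dist x v = k := by omega
  have hdk := hdist k (by omega)
  by_cases h1 : f k = v ∨ G.Adj (f k) v
  · exact ⟨k, by omega, h1, by omega, by omega⟩
  push Not at h1
  rcases k with _ | k
  · exfalso; apply h1.1; rw [hf0]; exact hconn.dist_eq_zero_iff.1 hdv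
  have hdk' := hdist k (by omega)
  refine ⟨k, by omega, Or.inr ?_, by omega, by omega⟩
  by_contra hnk
  have hmin := (hdn (k+1) (by omega)).2 v (by simp [dn, hzv.symm]; omega)
  have hfk : f k ∈ dn (f (k+1)) := (hdn k (by omega)).1
  have hfk' : f k ∉ dn v := by simp [dn, hnk]
  have hex : ∃ b ∈ dn v, b ∉ dn (f (k+1)) := by
    by_contra hcon
    push Not at hcon
    have : dn v ⊂ dn (f (k+1)) := by
      rw [Finset.ssubset_iff_of_subset hcon]
      exact ⟨_, hfk, hfk'⟩
    have := Finset.card_lt_card this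
    omega
  obtain ⟨b, hb, hb'⟩ := hex
  simp only [dn, Finset.mem_filter, Finset.mem_univ, true_and] at hb hb'
  rcases k with _ | k
  · have : x = b := hconn.dist_eq_zero_iff.1 (by omega)
    apply hnk; rw [hf0, this]; exact hb.1
  refine at_lemma G hconn hAT x (f (k+1+1)) v (f (k+1+1+1)) (f (k+1)) b k (by omega) (by omega)
    (hadj _ (by omega)) hzv.symm (by omega) h1.1 h1.2 (hadj _ (by omega)) (by omega) hnk hb.1 (by omega) ?_
  intro h
  exact hb' ⟨h, by omega⟩

lemma pd_iff {V : Type*} (G : SimpleGraph V) (D : Finset V) :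
    IsPairedDominating G (↑D : Set V) ↔ (∃ σ, Mt G D σ) ∧ ∀ u, Cov G D u := by
  unfold IsPairedDominating
  rw [mt_iff, and_comm]
  rfl

/-- Number of vertices of `D` on levels `u, …, v`. -/
noncomputable def cnt {V : Type*} (G : SimpleGraph V) (x : V) (D : Finset V) (u v : ℕ) : ℕ :=
  (D.filter (fun w => u ≤ G.dist x w ∧ G.dist x w ≤ v)).card

lemma cnt_add {V : Type*} (G : SimpleGraph V) (x : V) (D : Finset V) (u v w : ℕ) (h1 : u ≤ v + 1)
    (h2 : v ≤ w) : cnt G x D u v + cnt G x D (v+1) w = cnt G x D u w := by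
  classical
  unfold cnt
  rw [← Finset.card_union_of_disjoint]
  · congr 1
    ext z
    simp only [Finset.mem_union, Finset.mem_filter]
    constructor
    · rintro (⟨h, h'⟩ | ⟨h, h'⟩) <;> exact ⟨h, by omega⟩
    · rintro ⟨h, h'⟩
      by_cases hz : G.dist x z ≤ v
      · left; exact ⟨h, by omega⟩
      · right; exact ⟨h, by omega⟩
  · rw [Finset.disjoint_left]
    intro z hz hz'
    simp only [Finset.mem_filter] at hz hz'
    omega

lemma cnt_pos {V : Type*} (G : SimpleGraph V) (x : V) (D : Finset V) (u v : ℕ) (w : V) (hw : w ∈ D)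
    (h1 : u ≤ G.dist x w) (h2 : G.dist x w ≤ v) : 1 ≤ cnt G x D u v :=
  Finset.card_pos.2 ⟨w, Finset.mem_filter.2 ⟨hw, h1, h2⟩⟩

lemma cnt_zero {V : Type*} (G : SimpleGraph V) (x : V) (D : Finset V) (u v : ℕ)
    (h : ∀ w ∈ D, u ≤ G.dist x w → G.dist x w ≤ v → False) : cnt G x D u v = 0 := by
  unfold cnt
  rw [Finset.card_eq_zero, Finset.filter_eq_empty_iff]
  intro w hw h'
  exact h w hw h'.1 h'.2

lemma cnt_le {V : Type*} (G : SimpleGraph V) (x : V) (D E : Finset V) (u v u' v' : ℕ)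
    (h : ∀ w ∈ D, u ≤ G.dist x w → G.dist x w ≤ v → w ∈ E ∧ u' ≤ G.dist x w ∧ G.dist x w ≤ v') :
    cnt G x D u v ≤ cnt G x E u' v' := by
  unfold cnt
  apply Finset.card_le_card
  intro w hw
  simp only [Finset.mem_filter] at hw ⊢
  exact h w hw.1 hw.2.1 hw.2.2

lemma cnt_union {V : Type*} [DecidableEq V] (G : SimpleGraph V) (x : V) (D E : Finset V) (u v : ℕ) :
    cnt G x (D ∪ E) u v ≤ cnt G x D u v + cnt G x E u v := by
  unfold cnt
  rw [Finset.filter_union]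
  exact Finset.card_union_le _ _

lemma improve {V : Type*} [Fintype V] (G : SimpleGraph V)
    (hconn : G.Connected) (hiso : ∀ v : V, ∃ u : V, G.Adj v u)
    (x : V) (l : ℕ) (hlmax : ∀ w : V, G.dist x w ≤ l)
    (d : ℕ) (f : ℕ → V) (hf : ∀ k < d, G.Adj (f k) (f (k+1))) (hfd : ∀ k ≤ d, G.dist x (f k) = k)
    (hfc : ∀ v, ∃ m ≤ d, (f m = v ∨ G.Adj (f m) v) ∧ m ≤ G.dist x v ∧ G.dist x v ≤ m + 1)
    (D : Finset V) (hσ : ∃ σ, Mt G D σ) (hcov : ∀ u, Cov G D u)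
    (hmin : ∀ E : Finset V, (∃ τ, Mt G E τ) → (∀ u, Cov G E u) → D.card ≤ E.card)
    (a b : ℕ) (hab : a ≤ b) (hbl : b ≤ l) (hviol : b - a + 5 ≤ cnt G x D a b)
    (hmax : ∀ u v, u ≤ a → b ≤ v → v ≤ l → (u < a ∨ b < v) → cnt G x D u v ≤ v - u + 4) :
    ∃ D' : Finset V, (∃ τ, Mt G D' τ) ∧ (∀ u, Cov G D' u) ∧ D'.card ≤ D.card ∧
      (∀ u v, u ≤ v → v ≤ l → v - u + 5 ≤ cnt G x D' u v → v - u + 5 ≤ cnt G x D u v) ∧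
      cnt G x D' a b < b - a + 5 := by
  classical
  obtain ⟨σ, hσ⟩ := hσ
  have hleft : ∀ u, u < a → cnt G x D u (a-1) + 1 + u ≤ a := by
    intro u hu
    have h1 := cnt_add G x D u (a-1) b (by omega) (by omega)
    rw [show a - 1 + 1 = a by omega] at h1
    have h2 := hmax u b (by omega) le_rfl hbl (Or.inl hu)
    omega
  have hright : ∀ v, b < v → v ≤ l → cnt G x D (b+1) v + b + 1 ≤ v := by
    intro v hv hvl
    have h1 := cnt_add G x D a b v (by omega) (by omega)
    have h2 := hmax a v le_rfl (by omega) hvl (Or.inr hv)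
    omega
  have hnoL : ∀ w ∈ D, G.dist x w + 1 ≠ a := by
    intro w hw he
    have h1 := hleft (a-1) (by omega)
    have h2 := cnt_pos G x D (a-1) (a-1) w hw (by omega) (by omega)
    omega
  have hnoR : ∀ w ∈ D, G.dist x w ≠ b + 1 := by
    intro w hw he
    have h0 := hlmax w
    have h1 := hright (b+1) (by omega) (by omega)
    have h2 := cnt_pos G x D (b+1) (b+1) w hw (by omega) (by omega)
    omega
  have hclos : ∀ w ∈ D, a ≤ G.dist x w ∧ G.dist x w ≤ b → a ≤ G.dist x (σ w) ∧ G.dist x (σ w) ≤ b := by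
    intro w hw hI
    obtain ⟨p, q, r⟩ := hσ w hw
    have h1 := hnoL _ p
    have h2 := hnoR _ p
    have h3 := dist_adj G hconn x r
    omega
  let D0 := D.filter (fun w => ¬ (a ≤ G.dist x w ∧ G.dist x w ≤ b))
  let DI := D.filter (fun w => (a ≤ G.dist x w ∧ G.dist x w ≤ b))
  have hMI : Mt G DI σ := by
    intro w hw
    simp only [DI, Finset.mem_filter] at hw ⊢
    obtain ⟨p, q, r⟩ := hσ w hw.1
    exact ⟨⟨p, hclos w hw.1 hw.2⟩, q, r⟩
  have hM0 : Mt G D0 σ := by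
    intro w hw
    simp only [D0, Finset.mem_filter] at hw ⊢
    obtain ⟨p, q, r⟩ := hσ w hw.1
    refine ⟨⟨p, fun h => hw.2 ?_⟩, q, r⟩
    have := hclos _ p h
    rwa [q] at this
  obtain ⟨N2, hN2⟩ := mt_even G DI σ hMI
  have hNc : cnt G x D a b = DI.card := rfl
  have hsum : DI.card + D0.card = D.card := Finset.card_filter_add_card_filter_not _
  have hD0D : D0 ⊆ D := Finset.filter_subset _ _
  have hC : ∀ E : Finset V, D0 ⊆ E → (∀ k, a - 2 ≤ k → k ≤ b + 1 → k ≤ d → f k ∈ E) → ∀ v, Cov G E v := by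
    intro E h1 h2 v
    obtain ⟨z, hz, hzv⟩ := hcov v
    by_cases hI : a ≤ G.dist x z ∧ G.dist x z ≤ b
    · obtain ⟨m, hm, hc, hl1, hl2⟩ := hfc v
      have : a ≤ G.dist x v + 1 ∧ G.dist x v ≤ b + 1 := by
        rcases hzv with rfl | hzv
        · omega
        · have := dist_adj G hconn x hzv
          omega
      exact ⟨f m, h2 m (by omega) (by omega) hm, hc⟩
    · exact ⟨z, h1 (Finset.mem_filter.2 ⟨hz, hI⟩), hzv⟩
  have hstrict : ∀ m n s, n ≤ 2 * m → s + n ≤ d + 1 →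
      (∀ k, a - 2 ≤ k → k ≤ b + 1 → k ≤ d → f k ∈ D0 ∨ (s ≤ k ∧ k < s + n)) → DI.card ≤ 2 * m := by
    intro m n s h1 h2 h3
    obtain ⟨D', g1, g2, g3⟩ := add_path G hiso d f hf m n s h1 h2 D0 ⟨σ, hM0⟩
    have := hmin D' g1 (fun u => g3 u (hC _ Finset.subset_union_left (by
      intro k k1 k2 k3
      rcases h3 k k1 k2 k3 with h | h
      · exact Finset.mem_union_left _ h
      · exact Finset.mem_union_right _ (Finset.mem_image.2 ⟨k, by simp; omega, rfl⟩)) u))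
    omega
  have had : a ≤ d + 1 := by
    have : 0 < DI.card := by omega
    obtain ⟨w, hw⟩ := Finset.card_pos.1 this
    simp only [DI, Finset.mem_filter] at hw
    obtain ⟨m, hm, hc, hl1, hl2⟩ := hfc w
    omega
  have hst1 := hstrict ((min (b+2) (d+1) - (a-2) + 1) / 2) (min (b+2) (d+1) - (a-2)) (a-2) (by omega)
    (by omega) (by intro k k1 k2 k3; right; omega)
  have ha2 : 2 ≤ a := by omega
  have hbd : b + 1 ≤ d := by omega
  have hN : DI.card = b - a + 5 := by omega
  obtain ⟨m, hm⟩ : ∃ m, 2 * m = b - a + 3 := ⟨(b-a+3)/2, by omega⟩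
  have hdv := hfd (a-2) (by omega)
  have hdw := hfd (a-1) (by omega)
  have hvD : f (a-2) ∉ D := by
    intro hv
    have := hstrict m (2*m) (a-1) le_rfl (by omega) (by
      intro k k1 k2 k3
      by_cases hk : k = a - 2
      · left; subst hk; exact Finset.mem_filter.2 ⟨hv, by omega⟩
      · right; omega)
    omega
  have hinj : ∀ k ≤ d, ∀ k' ≤ d, f k = f k' → k = k' := by
    intro k hk k' hk' h
    rw [← hfd k hk, ← hfd k' hk', h]
  obtain ⟨τ, hτ⟩ := add_path_exact G d f hf hinj D0 ⟨σ, hM0⟩ m (a-1) (by omega) (by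
    intro k k1 k2 hk
    simp only [D0, Finset.mem_filter] at hk
    have e := hfd k (by omega)
    have e1 := hnoL _ hk.1
    have e2 := hnoR _ hk.1
    have := hk.2
    omega)
  set D2 := D0 ∪ (Finset.Ico (a-1) (a-1+2*m)).image f with hD2
  have hD2c : D2.card ≤ D0.card + 2 * m := by
    have h1 := Finset.card_union_le D0 ((Finset.Ico (a-1) (a-1+2*m)).image f)
    rw [← hD2] at h1
    have h2 := Finset.card_image_le (s := Finset.Ico (a-1) (a-1+2*m)) (f := f)
    simp only [Nat.card_Ico] at h2
    omega
  have hvD2 : f (a-2) ∉ D2 := by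
    simp only [hD2, Finset.mem_union, Finset.mem_image, Finset.mem_Ico, not_or, not_exists, not_and]
    refine ⟨fun h => hvD (hD0D h), fun k hk e => ?_⟩
    have := hinj k (by omega) (a-2) (by omega) e
    omega
  have hcov2 : ∀ E : Finset V, insert (f (a-2)) D2 ⊆ E → ∀ u, Cov G E u := by
    intro E hE
    apply hC
    · intro z hz
      exact hE (Finset.mem_insert_of_mem (Finset.mem_union_left _ hz))
    · intro k k1 k2 k3
      apply hE
      by_cases hk : k = a - 2
      · rw [hk]; simp
      · exact Finset.mem_insert_of_mem (Finset.mem_union_right _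
          (Finset.mem_image.2 ⟨k, by simp; omega, rfl⟩))
  have hvw : G.Adj (f (a-2)) (f (a-1)) := by
    have := hf (a-2) (by omega)
    rwa [show a - 2 + 1 = a - 1 by omega] at this
  rcases add_one G D2 τ hτ (f (a-2)) (f (a-1)) hvD2 hvw with ⟨e, he, hev, ht, hadj⟩ | ⟨D', h1, h2, h3⟩
  swap
  · have := hmin D' h1 (fun u => h3 u (hcov2 _ (Finset.Subset.refl _) u))
    omega
  have hde : a ≤ G.dist x e + 3 ∧ G.dist x e ≤ a + 1 := by
    rcases hadj with h | ⟨hw, h⟩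
    · have := dist_adj G hconn x h
      omega
    · have g1 := dist_adj G hconn x h
      have g2 := dist_adj G hconn x (hτ _ hw).2.2
      omega
  set D' := insert (f (a-2)) (insert e D2) with hD'
  have hcnt : ∀ u v, cnt G x D' u v ≤ cnt G x D0 u v + (min v (b+1) + 1 - max u (a-2)) + cnt G x {e} u v := by
    intro u v
    have h1 : cnt G x D' u v ≤ cnt G x (D0 ∪ (Finset.Icc (a-2) (b+1)).image f ∪ {e}) u v := by
      apply cnt_le
      intro w hw g1 g2
      refine ⟨?_, g1, g2⟩
      simp only [hD', hD2, Finset.mem_insert, Finset.mem_union, Finset.mem_image, Finset.mem_Ico,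
        Finset.mem_Icc, Finset.mem_singleton] at hw ⊢
      rcases hw with rfl | rfl | hw | ⟨k, hk, rfl⟩
      · left; right; exact ⟨a-2, by omega, rfl⟩
      · right; rfl
      · left; left; exact hw
      · left; right; exact ⟨k, by omega, rfl⟩
    have h2 := cnt_union G x (D0 ∪ (Finset.Icc (a-2) (b+1)).image f) {e} u v
    have h3 := cnt_union G x D0 ((Finset.Icc (a-2) (b+1)).image f) u v
    have h4 : cnt G x ((Finset.Icc (a-2) (b+1)).image f) u v ≤ min v (b+1) + 1 - max u (a-2) := by
      rw [← Nat.card_Icc]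
      refine le_trans (Finset.card_le_card (t := (Finset.Icc (max u (a-2)) (min v (b+1))).image f) ?_)
        Finset.card_image_le
      intro w hw
      simp only [Finset.mem_filter, Finset.mem_image, Finset.mem_Icc] at hw ⊢
      obtain ⟨⟨k, hk, rfl⟩, g1, g2⟩ := hw
      have := hfd k (by omega)
      exact ⟨k, by omega, rfl⟩
    omega
  have he1 : ∀ u v, cnt G x {e} u v ≤ 1 := by
    intro u v
    exact le_trans (Finset.card_filter_le _ _) (by simp)
  have he0 : ∀ u v, (G.dist x e < u ∨ v < G.dist x e) → cnt G x {e} u v = 0 := by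
    intro u v h
    apply cnt_zero
    intro w hw
    rw [Finset.mem_singleton] at hw
    subst hw
    omega
  have hmem0 : ∀ w ∈ D0, ¬ (a ≤ G.dist x w ∧ G.dist x w ≤ b) := fun w hw => (Finset.mem_filter.1 hw).2
  refine ⟨D', ht, hcov2 _ ?_, ?_, ?_, ?_⟩
  · exact Finset.insert_subset_insert _ (Finset.subset_insert _ _)
  · have a1 := Finset.card_insert_le (f (a-2)) (insert e D2)
    rw [← hD'] at a1
    have a2 := Finset.card_insert_le e D2
    omega
  · intro u v huv hvl hbad
    have hc := hcnt u v
    have hc1 := he1 u v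
    have hc0 := he0 u v
    by_cases hsub : u ≤ a ∧ b ≤ v
    · have : cnt G x D0 u v + DI.card ≤ cnt G x D u v := by
        unfold cnt
        rw [← Finset.card_union_of_disjoint]
        · apply Finset.card_le_card
          intro z hz
          simp only [Finset.mem_union, Finset.mem_filter, D0, DI] at hz ⊢
          rcases hz with ⟨⟨h1, -⟩, h2⟩ | ⟨h1, h2⟩
          · exact ⟨h1, h2⟩
          · exact ⟨h1, by omega⟩
        · rw [Finset.disjoint_left]
          intro z hz hz'
          simp only [Finset.mem_filter, D0, DI] at hz hz'
          exact hz.1.2 hz'.2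
      omega
    have h0D : cnt G x D0 u v ≤ cnt G x D u v := cnt_le _ _ _ _ _ _ _ _ (fun w hw g1 g2 => ⟨hD0D hw, g1, g2⟩)
    by_cases hvb : v < b
    · by_cases hua : u < a
      · have h1 : cnt G x D0 u v ≤ cnt G x D u (a-1) := by
          apply cnt_le
          intro w hw g1 g2
          have := hmem0 w hw
          exact ⟨hD0D hw, g1, by omega⟩
        have h2 := hleft u hua
        omega
      · have h1 : cnt G x D0 u v = 0 := by
          apply cnt_zero
          intro w hw g1 g2
          have := hmem0 w hw
          omega
        omega
    · by_cases hvb' : b < v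
      · have h1 : cnt G x D0 u v ≤ cnt G x D (b+1) v := by
          apply cnt_le
          intro w hw g1 g2
          have := hmem0 w hw
          exact ⟨hD0D hw, by omega, g2⟩
        have h2 := hright v hvb' hvl
        omega
      · have h1 : cnt G x D0 u v = 0 := by
          apply cnt_zero
          intro w hw g1 g2
          have := hmem0 w hw
          omega
        omega
  · have hc := hcnt a b
    have hc1 := he1 a b
    have h1 : cnt G x D0 a b = 0 := by
      apply cnt_zero
      intro w hw g1 g2
      have := hmem0 w hw
      omega
    omega

/-- Let `G` be a finite connected AT-free simple graph with no isolated vertices and a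
dominating pair `(x, y)`, let `Lᵢ = {w : d_G(x, w) = i}` be the BFS-levels from `x` and
let `l` be the largest index with `L_l` nonempty.  Then there is a minimum cardinality
paired dominating set `D_p` of `G` with
`|D_p ∩ (Lᵢ ∪ ⋯ ∪ L_{i+j})| ≤ j + 4` for all `0 ≤ i ≤ l` and `0 ≤ j ≤ l - i`. -/
theorem atfree_min_pd_set_bounded_on_levels {V : Type*} [Fintype V] (G : SimpleGraph V)
    (hconn : G.Connected) (hAT : ATFree G) (hiso : ∀ v : V, ∃ u : V, G.Adj v u)
    (x y : V) (hdp : IsDominatingPair G x y)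
    (l : ℕ) (hl : ∃ w : V, G.dist x w = l) (hlmax : ∀ w : V, G.dist x w ≤ l) :
    ∃ Dp : Finset V, IsPairedDominating G (↑Dp : Set V) ∧
      Dp.card = pairedDominationNumber G ∧
      ∀ i j : ℕ, i ≤ l → j ≤ l - i →
        (Dp.filter (fun w => i ≤ G.dist x w ∧ G.dist x w ≤ i + j)).card ≤ j + 4 := by
  classical
  let S : Finset (Finset V) := Finset.univ.filter (fun D => IsPairedDominating G (↑D : Set V) ∧
    D.card = pairedDominationNumber G)
  let viol : Finset V → Finset (ℕ × ℕ) := fun D =>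
    ((Finset.range (l+1)) ×ˢ (Finset.range (l+1))).filter
      (fun q => q.1 ≤ q.2 ∧ q.2 - q.1 + 5 ≤ cnt G x D q.1 q.2)
  obtain ⟨d, f, hf, hfd, hfc⟩ := good_path G hconn hAT x y hdp
  have hne : {n : ℕ | ∃ D : Finset V, IsPairedDominating G (↑D : Set V) ∧ D.card = n}.Nonempty := by
    obtain ⟨D', h1, -, h3⟩ := add_path G hiso d f hf (d+1) (d+1) 0 (by omega) (by omega) ∅
      ⟨id, by intro v hv; simp at hv⟩
    refine ⟨D'.card, D', (pd_iff G D').2 ⟨h1, fun u => h3 u ?_⟩, rfl⟩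
    obtain ⟨m, hm, hc, -⟩ := hfc u
    exact ⟨f m, by simp; exact ⟨m, by omega, rfl⟩, hc⟩
  have hSne : S.Nonempty := by
    obtain ⟨D, h1, h2⟩ := Nat.sInf_mem hne
    exact ⟨D, by simp only [S, Finset.mem_filter, Finset.mem_univ, true_and]; exact ⟨h1, h2⟩⟩
  obtain ⟨D, hDS, hDmin⟩ := Finset.exists_min_image S (fun D => (viol D).card) hSne
  have hDS' := hDS
  simp only [S, Finset.mem_filter, Finset.mem_univ, true_and] at hDS'
  obtain ⟨hpd, hcard⟩ := hDS'
  have hmin : ∀ E : Finset V, (∃ τ, Mt G E τ) → (∀ u, Cov G E u) → D.card ≤ E.card := by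
    intro E h1 h2
    rw [hcard]
    exact Nat.sInf_le ⟨E, (pd_iff G E).2 ⟨h1, h2⟩, rfl⟩
  refine ⟨D, hpd, hcard, ?_⟩
  by_contra hcon
  push Not at hcon
  obtain ⟨i, j, hi, hj, hij⟩ := hcon
  have hvne : (viol D).Nonempty := by
    refine ⟨(i, i+j), ?_⟩
    simp only [viol, Finset.mem_filter, Finset.mem_product, Finset.mem_range]
    refine ⟨⟨by omega, by omega⟩, by omega, ?_⟩
    unfold cnt
    omega
  obtain ⟨⟨a, b⟩, hab, hmax⟩ := Finset.exists_max_image (viol D) (fun q => q.2 - q.1) hvne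
  have hab' := hab
  simp only [viol, Finset.mem_filter, Finset.mem_product, Finset.mem_range] at hab'
  obtain ⟨⟨ha, hb⟩, hle, hv⟩ := hab'
  obtain ⟨hσ, hcov⟩ := (pd_iff G D).1 hpd
  obtain ⟨D', h1, h2, h3, h4, h5⟩ := improve G hconn hiso x l hlmax d f hf hfd hfc D hσ hcov hmin a b hle
    (by omega) hv (by
      intro u v hu hv hvl hs
      by_contra hc
      have := hmax (u, v) (by
        simp only [viol, Finset.mem_filter, Finset.mem_product, Finset.mem_range]
        refine ⟨⟨by omega, by omega⟩, by omega, by omega⟩)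
      simp only at this
      omega)
  have hD'S : D' ∈ S := by
    simp only [S, Finset.mem_filter, Finset.mem_univ, true_and]
    refine ⟨(pd_iff G D').2 ⟨h1, h2⟩, ?_⟩
    have := hmin D' h1 h2
    omega
  have hlt : viol D' ⊂ viol D := by
    rw [Finset.ssubset_iff_of_subset]
    · refine ⟨(a, b), hab, ?_⟩
      simp only [viol, Finset.mem_filter, not_and]
      intro _ _
      omega
    · rintro ⟨u, v⟩ hq
      simp only [viol, Finset.mem_filter, Finset.mem_product, Finset.mem_range] at hq ⊢
      exact ⟨hq.1, hq.2.1, h4 u v hq.2.1 (by omega) hq.2.2⟩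
  have := Finset.card_lt_card hlt
  have := hDmin D' hD'S
  omega
end
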